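/- For all $\psi,\theta,\varphi\in\mathbb R$ and all $n\in\mathbb Z$, put $\hat\psi=\psi/2$, $\hat\theta=\theta/2$, $\hat\varphi_n=\varphi/2-\pi/4+n\pi/2$, and define $$q_0=\cos\hat\psi\cos\hat\theta\cos\hat\varphi_n-\cos\hat\varphi_n\sin\hat\psi\sin\hat\theta,\qquad q_1=\cos\hat\psi\sin\hat\theta\sin\hat\varphi_n-\cos\hat\theta\sin\hat\psi\sin\hat\varphi_n,$$ $$q_2=-\cos\hat\psi\cos\hat\theta\sin\hat\varphi_n-\sin\hat\psi\sin\hat\theta\sin\hat\varphi_n,\qquad q_3=\cos\hat\psi\cos\hat\varphi_n\sin\hat\theta+\cos\hat\theta\cos\hat\varphi_n\sin\hat\psi.$$ Then $\mathbf q=(q_0,q_1,q_2,q_3)$ is a unit quaternion. Let $R(\mathbf q)=I_3+2q_0[q_v]_\times+2[q_v]_\times^2$ be its rotation matrix (Euler–Rodrigues formula), where $q_v=(q_1,q_2,q_3)$ and $[q_v]_\times$ is the skew-symmetric matrix with $[q_v]_\times y=q_v\times y$. The image of $(0,0,1)$ under $R(\mathbf q)$ is $$v=\bigl(2(q_1q_3+q_0q_2),\;2(q_2q_3-q_0q_1),\;q_0^2-q_1^2-q_2^2+q_3^2\bigr)\in\mathbb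 R^3,$$ and $v$ is orthogonal to both the polar tangent vector $(-\cos\theta\sin\varphi,-\sin\theta\sin\varphi,\cos\varphi)$ and the azimuthal tangent vector $(-\sin\theta,\cos\theta,0)$, i.e. both Euclidean inner products vanish. Consequently, if $P_{\theta\varphi}$ is the $2\times3$ matrix whose rows are these two tangent vectors, then $P_{\theta\varphi}\,R(\mathbf q)\,(0,0,T)^{\mathrm T}=0$ for every thrust $T\in\mathbb R$. -/

import Mathlib

open scoped Quaternion Matrix

noncomputable section

namespace UAVObject

/-- The skew-symmetric matrix `x̂` with `x̂ y = x × y`. -/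
def skew (x : Fin 3 → ℝ) : Matrix (Fin 3) (Fin 3) ℝ :=
  !![0, -x 2, x 1;
     x 2, 0, -x 0;
     -x 1, x 0, 0]

/-- The imaginary part `q_v = (q₁, q₂, q₃)` of a quaternion. -/
def imVec (q : ℍ[ℝ]) : Fin 3 → ℝ := ![q.imI, q.imJ, q.imK]

/-- Euler–Rodrigues formula: the rotation matrix `I + 2 q₀ q̂_v + 2 q̂_v²` of a unit quaternion
`q = q₀ + q_v`. -/
def rotationMatrix (q : ℍ[ℝ]) : Matrix (Fin 3) (Fin 3) ℝ :=
  1 + (2 * q.re) • skew (imVec q) + (2 : ℝ) • (skew (imVec q) * skew (imVec q))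

/-- The polar tangent vector (the polar angle `φ` is measured from the horizontal plane). -/
def polarVec (θ φ : ℝ) : Fin 3 → ℝ :=
  ![-(Real.cos θ * Real.sin φ), -(Real.sin θ * Real.sin φ), Real.cos φ]

/-- The azimuthal tangent vector. -/
def azimuthVec (θ : ℝ) : Fin 3 → ℝ := ![-Real.sin θ, Real.cos θ, 0]

/-- The projection matrix whose rows are the polar and the azimuthal tangent vectors. -/
def projMatrix (θ φ : ℝ) : Matrix (Fin 2) (Fin 3) ℝ :=
  Matrix.of ![polarVec θ φ, azimuthVec θ]

/-- The generalized force produced on the object at `(θ, φ)` by the thrust `T` at attitude `q`. -/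
def genForce (θ φ : ℝ) (q : ℍ[ℝ]) (T : ℝ) : Fin 2 → ℝ :=
  projMatrix θ φ *ᵥ (rotationMatrix q *ᵥ ![0, 0, T])

/-- The angle `φ/2 - π/4 + nπ/2`. -/
def halfPolar (φ : ℝ) (n : ℤ) : ℝ := φ / 2 - Real.pi / 4 + n * (Real.pi / 2)

/-- The kernel quaternion with yaw angle `ψ` at the object position `(θ, φ)`. -/
def kernelQuaternion (ψ θ φ : ℝ) (n : ℤ) : ℍ[ℝ] where
  re := Real.cos (ψ / 2) * Real.cos (θ / 2) * Real.cos (halfPolar φ n) -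
    Real.cos (halfPolar φ n) * Real.sin (ψ / 2) * Real.sin (θ / 2)
  imI := Real.cos (ψ / 2) * Real.sin (θ / 2) * Real.sin (halfPolar φ n) -
    Real.cos (θ / 2) * Real.sin (ψ / 2) * Real.sin (halfPolar φ n)
  imJ := -(Real.cos (ψ / 2) * Real.cos (θ / 2) * Real.sin (halfPolar φ n)) -
    Real.sin (ψ / 2) * Real.sin (θ / 2) * Real.sin (halfPolar φ n)
  imK := Real.cos (ψ / 2) * Real.cos (halfPolar φ n) * Real.sin (θ / 2) +
    Real.cos (θ / 2) * Real.cos (halfPolar φ n) * Real.sin (ψ / 2)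

end UAVObject

end

namespace UAVObject

open Real

/-- The third column of the rotation matrix of a unit quaternion. -/
theorem rotationMatrix_mulVec_e3 {q : ℍ[ℝ]}
    (hq : q.re ^ 2 + q.imI ^ 2 + q.imJ ^ 2 + q.imK ^ 2 = 1) :
    rotationMatrix q *ᵥ ![0, 0, 1] =
      ![2 * (q.imI * q.imK + q.re * q.imJ),
        2 * (q.imJ * q.imK - q.re * q.imI),
        q.re ^ 2 - q.imI ^ 2 - q.imJ ^ 2 + q.imK ^ 2] := by
  ext i
  fin_cases i <;>
    simp [rotationMatrix, skew, imVec, Matrix.mulVec, dotProduct, Fin.sum_univ_three,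
      Matrix.one_apply] <;>
    linarith

theorem kernelQuaternion_eq (ψ θ φ : ℝ) (n : ℤ) :
    kernelQuaternion ψ θ φ n =
      ⟨cos (halfPolar φ n) * cos (θ / 2 + ψ / 2), sin (halfPolar φ n) * sin (θ / 2 - ψ / 2),
        -(sin (halfPolar φ n) * cos (θ / 2 - ψ / 2)),
        cos (halfPolar φ n) * sin (θ / 2 + ψ / 2)⟩ := by
  ext <;> simp only [kernelQuaternion, cos_add, sin_add, cos_sub, sin_sub] <;> ring

theorem kernelQuaternion_sq_sum (ψ θ φ : ℝ) (n : ℤ) :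
    (kernelQuaternion ψ θ φ n).re ^ 2 + (kernelQuaternion ψ θ φ n).imI ^ 2 +
      (kernelQuaternion ψ θ φ n).imJ ^ 2 + (kernelQuaternion ψ θ φ n).imK ^ 2 = 1 := by
  rw [kernelQuaternion_eq]
  linear_combination cos (halfPolar φ n) ^ 2 * sin_sq_add_cos_sq (θ / 2 + ψ / 2) +
    sin (halfPolar φ n) ^ 2 * sin_sq_add_cos_sq (θ / 2 - ψ / 2) +
    sin_sq_add_cos_sq (halfPolar φ n)

theorem norm_kernelQuaternion (ψ θ φ : ℝ) (n : ℤ) : ‖kernelQuaternion ψ θ φ n‖ = 1 := by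
  rw [← sq_eq_sq₀ (norm_nonneg _) zero_le_one, one_pow, sq, ← Quaternion.normSq_eq_norm_mul_self,
    Quaternion.normSq_def', kernelQuaternion_sq_sum]

/-- The thrust direction of the kernel quaternion in spherical coordinates. -/
theorem rotationMatrix_kernelQuaternion_mulVec_e3 (ψ θ φ : ℝ) (n : ℤ) :
    rotationMatrix (kernelQuaternion ψ θ φ n) *ᵥ ![0, 0, 1] =
      ![-(sin (2 * halfPolar φ n) * cos θ), -(sin (2 * halfPolar φ n) * sin θ),
        cos (2 * halfPolar φ n)] := by
  have hθ : θ = (θ / 2 + ψ / 2) + (θ / 2 - ψ / 2) := by ring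
  have hc : cos θ = cos (θ / 2 + ψ / 2) * cos (θ / 2 - ψ / 2) -
      sin (θ / 2 + ψ / 2) * sin (θ / 2 - ψ / 2) := by rw [← cos_add, ← hθ]
  have hs : sin θ = sin (θ / 2 + ψ / 2) * cos (θ / 2 - ψ / 2) +
      cos (θ / 2 + ψ / 2) * sin (θ / 2 - ψ / 2) := by rw [← sin_add, ← hθ]
  rw [rotationMatrix_mulVec_e3 (kernelQuaternion_sq_sum ψ θ φ n), kernelQuaternion_eq, hc, hs,
    sin_two_mul, cos_two_mul']
  congr 1
  · ring
  congr 1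
  · ring
  congr 1
  linear_combination cos (halfPolar φ n) ^ 2 * sin_sq_add_cos_sq (θ / 2 + ψ / 2) -
    sin (halfPolar φ n) ^ 2 * sin_sq_add_cos_sq (θ / 2 - ψ / 2)

theorem cos_two_mul_halfPolar_sub (φ : ℝ) (n : ℤ) : cos (2 * halfPolar φ n - φ) = 0 := by
  rw [show 2 * halfPolar φ n - φ = n * π - π / 2 by unfold halfPolar; ring, cos_sub_pi_div_two,
    sin_int_mul_pi]

theorem kernelQuaternion_thrust_dotProduct_polarVec (ψ θ φ : ℝ) (n : ℤ) :
    (rotationMatrix (kernelQuaternion ψ θ φ n) *ᵥ ![0, 0, 1]) ⬝ᵥ polarVec θ φ = 0 := by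
  have h := cos_two_mul_halfPolar_sub φ n
  rw [cos_sub] at h
  rw [rotationMatrix_kernelQuaternion_mulVec_e3]
  simp only [polarVec, dotProduct, Fin.sum_univ_three, Matrix.cons_val]
  linear_combination h + sin (2 * halfPolar φ n) * sin φ * sin_sq_add_cos_sq θ

theorem kernelQuaternion_thrust_dotProduct_azimuthVec (ψ θ φ : ℝ) (n : ℤ) :
    (rotationMatrix (kernelQuaternion ψ θ φ n) *ᵥ ![0, 0, 1]) ⬝ᵥ azimuthVec θ = 0 := by
  rw [rotationMatrix_kernelQuaternion_mulVec_e3]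
  simp only [azimuthVec, dotProduct, Fin.sum_univ_three, Matrix.cons_val]
  ring

theorem genForce_kernelQuaternion (ψ θ φ : ℝ) (n : ℤ) (T : ℝ) :
    genForce θ φ (kernelQuaternion ψ θ φ n) T = 0 := by
  have hT : (![0, 0, T] : Fin 3 → ℝ) = T • ![0, 0, 1] := by simp
  rw [genForce, hT, Matrix.mulVec_smul, Matrix.mulVec_smul]
  refine smul_eq_zero_of_right T (funext fun i => ?_)
  rw [Matrix.mulVec, dotProduct_comm]
  fin_cases i
  · exact kernelQuaternion_thrust_dotProduct_polarVec ψ θ φ n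
  · exact kernelQuaternion_thrust_dotProduct_azimuthVec ψ θ φ n

end UAVObject

/-- The kernel quaternion `q` is a unit quaternion; the image `v` of `(0, 0, 1)` under its rotation
is orthogonal to both tangent vectors; hence the generalized force vanishes for every thrust. -/
theorem kernel_quaternion_thrust_is_radial (ψ θ φ : ℝ) (n : ℤ) :
    let q : Quaternion ℝ := UAVObject.kernelQuaternion ψ θ φ n
    let v : Fin 3 → ℝ :=
      ![2 * (q.imI * q.imK + q.re * q.imJ),
        2 * (q.imJ * q.imK - q.re * q.imI),
        q.re ^ 2 - q.imI ^ 2 - q.imJ ^ 2 + q.imK ^ 2]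
    ‖q‖ = 1 ∧
      v = (UAVObject.rotationMatrix q).mulVec ![0, 0, 1] ∧
      dotProduct v (UAVObject.polarVec θ φ) = 0 ∧
      dotProduct v (UAVObject.azimuthVec θ) = 0 ∧
      ∀ T : ℝ, UAVObject.genForce θ φ q T = 0 := by
  intro q v
  have hv : v = (UAVObject.rotationMatrix q).mulVec ![0, 0, 1] :=
    (UAVObject.rotationMatrix_mulVec_e3 (UAVObject.kernelQuaternion_sq_sum ψ θ φ n)).symm
  refine ⟨UAVObject.norm_kernelQuaternion ψ θ φ n, hv, ?_, ?_,
    UAVObject.genForce_kernelQuaternion ψ θ φ n⟩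
  · rw [hv]
    exact UAVObject.kernelQuaternion_thrust_dotProduct_polarVec ψ θ φ n
  · rw [hv]
    exact UAVObject.kernelQuaternion_thrust_dotProduct_azimuthVec ψ θ φ n
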